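/- Let p be a prime, r ≥ 1, and G a finite abelian group with gcd(p, |G|) = 1. Then the group ring (ℤ/p^r ℤ)[G] is a principal ideal ring. -/

import Mathlib

/-- A commutative ring that is semisimple modulo a nilpotent element `a` is a principal ideal ring:
a prime ideal is generated by `e + a * (1 - e)`, where `e` lifts an idempotent generator of its
image in the quotient by `a`. -/
theorem IsPrincipalIdealRing.of_surjective_of_isSemisimpleRing {R S : Type*} [CommRing R]
    [CommRing S] [IsSemisimpleRing S] (f : R →+* S) (hf : Function.Surjective f) {a : R}
    (ha : IsNilpotent a) (hker : RingHom.ker f = Ideal.span {a}) :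
    IsPrincipalIdealRing R := by
  have hnil : ∀ x ∈ RingHom.ker f, IsNilpotent x := by
    intro x hx
    rw [hker, Ideal.mem_span_singleton] at hx
    obtain ⟨y, rfl⟩ := hx
    exact (Commute.all a y).isNilpotent_mul_right ha
  refine IsPrincipalIdealRing.of_prime fun P hP ↦ ?_
  obtain ⟨e', he', hPe'⟩ := IsSemisimpleRing.ideal_eq_span_idempotent (P.map f)
  obtain ⟨e, he, rfl⟩ := exists_isIdempotentElem_eq_of_ker_isNilpotent f hnil e' (hf e') he'
  have haP : a ∈ P := by
    obtain ⟨n, hn⟩ := ha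
    exact hP.mem_of_pow_mem n (hn ▸ P.zero_mem)
  have hP' : P = Ideal.span {e, a} := by
    have hkerP : RingHom.ker f ≤ P := by
      rwa [hker, Ideal.span_singleton_le_iff_mem]
    rw [← sup_eq_left.mpr hkerP, ← Ideal.comap_map_of_surjective' f hf, hPe',
      ← Set.image_singleton, ← Ideal.map_span, Ideal.comap_map_of_surjective' f hf, hker,
      Ideal.span_insert]
  have hee : e * e = e := he
  refine ⟨e + a * (1 - e), ?_⟩
  rw [hP', Ideal.submodule_span_eq]
  refine le_antisymm (Ideal.span_le.mpr ?_) ((Ideal.span_singleton_le_iff_mem _).mpr ?_)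
  · rintro x (rfl | rfl)
    · exact Ideal.mem_span_singleton.mpr ⟨x, by linear_combination (a - 1) * hee⟩
    · exact Ideal.mem_span_singleton.mpr ⟨x * e + (1 - e), by
        linear_combination (-(2 * x) + x ^ 2 + 1) * hee⟩
  · exact Ideal.mem_span_pair.mpr ⟨1, 1 - e, by ring⟩

theorem AddMonoidAlgebra.ker_mapRingHom_eq_span_singleton {R S M : Type*} [CommRing R] [CommRing S]
    [AddCommMonoid M] (f : R →+* S) {a : R} (hker : RingHom.ker f = Ideal.span {a}) :
    RingHom.ker (mapRingHom M f) = Ideal.span {single (0 : M) a} := by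
  refine le_antisymm (fun x hx ↦ ?_) ((Ideal.span_singleton_le_iff_mem _).mpr ?_)
  · rw [← sum_coeff_single x]
    refine Submodule.sum_mem _ fun m _ ↦ ?_
    have hm : x.coeff m ∈ RingHom.ker f := by
      rw [RingHom.mem_ker, ← coeff_mapRingHom, hx]
      rfl
    rw [hker, Ideal.mem_span_singleton] at hm
    obtain ⟨c, hc⟩ := hm
    exact Ideal.mem_span_singleton.mpr ⟨single m c, by rw [single_mul_single, zero_add, hc]⟩
  · have : f a = 0 := by
      rw [← RingHom.mem_ker, hker]
      exact Ideal.mem_span_singleton_self a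
    rw [RingHom.mem_ker, mapRingHom_single, this, single_zero]

theorem ZMod.ker_castHom_eq_span_singleton {m n : ℕ} (h : m ∣ n) :
    RingHom.ker (ZMod.castHom h (ZMod m)) = Ideal.span {(m : ZMod n)} := by
  ext x
  obtain ⟨k, rfl⟩ := ZMod.intCast_surjective x
  rw [RingHom.mem_ker, map_intCast, ZMod.intCast_zmod_eq_zero_iff_dvd, Ideal.mem_span_singleton]
  constructor
  · rintro ⟨c, rfl⟩
    exact ⟨c, by push_cast; rfl⟩
  · rintro ⟨y, hy⟩
    have := congrArg (ZMod.castHom h (ZMod m)) hy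
    rwa [map_mul, map_natCast, map_intCast, ZMod.natCast_self, zero_mul,
      ZMod.intCast_zmod_eq_zero_iff_dvd] at this


/-- For `r ≥ 1` and a finite abelian group `G` with `gcd(p, |G|) = 1`, the
group ring `(ℤ/p^rℤ)[G]` is a principal ideal ring. -/
theorem principal_ideal_group_ring_sufficient
    (p r : ℕ) (hp : p.Prime) (hr : 1 ≤ r)
    (G : Type*) [AddCommGroup G] [Fintype G]
    (hco : Nat.gcd p (Fintype.card G) = 1) :
    IsPrincipalIdealRing (AddMonoidAlgebra (ZMod (p ^ r)) G) := by
  have : Fact p.Prime := ⟨hp⟩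
  have hdvd : p ∣ p ^ r := dvd_pow_self p (by omega)
  have : NeZero (Nat.card G : ZMod p) := ⟨by
    rw [Nat.card_eq_fintype_card, Ne, ZMod.natCast_eq_zero_iff]
    exact hp.coprime_iff_not_dvd.mp hco⟩
  have : IsSemisimpleRing (AddMonoidAlgebra (ZMod p) G) := inferInstance
  refine IsPrincipalIdealRing.of_surjective_of_isSemisimpleRing
    (AddMonoidAlgebra.mapRingHom G (ZMod.castHom hdvd (ZMod p)))
    (AddMonoidAlgebra.map_surjective (ZMod.castHom hdvd (ZMod p)).toAddMonoidHom
      (ZMod.ringHom_surjective _)) ⟨r, ?_⟩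
    (AddMonoidAlgebra.ker_mapRingHom_eq_span_singleton _ (ZMod.ker_castHom_eq_span_singleton hdvd))
  rw [AddMonoidAlgebra.single_pow, ← Nat.cast_pow, ZMod.natCast_self, AddMonoidAlgebra.single_zero]
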